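/- Let f, g : ℝ → ℝ be continuously differentiable with bounded derivatives, and assume in addition that f is twice continuously differentiable with bounded second derivative. Then for every ξ > 0 and all u, v ∈ ℝ, the function v ↦ f^{β_ξ}(u,v) − g^{β_ξ}(v,u) is differentiable in v and |∂_v ( f^{β_ξ}(u,v) − g^{β_ξ}(v,u) )| ≤ 2 ξ ‖f''‖_∞ + |f'(v) − g'(v)|. -/

import Mathlib

open intervalIntegral

/-- The rescaled entropy function `β_ξ(r) = ξ β(r/ξ)`. -/
noncomputable def betaXi (β : ℝ → ℝ) (ξ : ℝ) : ℝ → ℝ := fun r => ξ * β (r / ξ)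

/-- The entropy flux `h^{β_ξ}(a,b) := ∫_b^a β_ξ'(r − b) h'(r) dr`. -/
noncomputable def fluxBeta (β : ℝ → ℝ) (ξ : ℝ) (h : ℝ → ℝ) (a b : ℝ) : ℝ :=
  ∫ r in b..a, deriv (betaXi β ξ) (r - b) * deriv h r

lemma core_aux (φ ρ : ℝ → ℝ) (ξ M L C : ℝ) (hξ : 0 < ξ) (hφ : ∀ x, HasDerivAt φ (ρ x) x)
    (hρc : Continuous ρ) (hρ0 : ∀ x, 0 ≤ ρ x) (hφ0 : φ 0 = 0) (hodd : ∀ x, φ (-x) = -φ x)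
    (hφ1 : ∀ x, |φ x| ≤ 1) (hsupp : ∀ x, ξ < |x| → ρ x = 0) (hL : ∀ x, |ρ x| ≤ L)
    (p p' q : ℝ → ℝ) (hp : ∀ x, HasDerivAt p (p' x) x) (hM : ∀ x, |p' x| ≤ M)
    (hC : ∀ x, |p x| ≤ C) (hq : Continuous q) (u v : ℝ) :
    ∃ D : ℝ, HasDerivAt (fun w => (∫ r in w..u, φ (r - w) * p r) -
        ∫ r in u..w, φ (r - u) * q r) D v ∧
      |D| ≤ 2 * ξ * M + |p v - q v| := by
  have hφc : Continuous φ := continuous_iff_continuousAt.2 fun x => (hφ x).continuousAt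
  have hpc : Continuous p := continuous_iff_continuousAt.2 fun x => (hp x).continuousAt
  have hM0 : 0 ≤ M := (abs_nonneg _).trans (hM 0)
  have hL0 : 0 ≤ L := (abs_nonneg _).trans (hL 0)
  have hC0 : 0 ≤ C := (abs_nonneg _).trans (hC 0)
  have hlipφ : ∀ x y, |φ x - φ y| ≤ L * |x - y| := fun x y => by
    have := Convex.norm_image_sub_le_of_norm_hasDerivWithin_le (f := φ) (f' := ρ) (s := Set.univ)
      (C := L) (x := y) (y := x) (fun x _ => (hφ x).hasDerivWithinAt) (fun x _ => hL x)
      convex_univ trivial trivial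
    simpa using this
  have hlipp : ∀ x y, |p x - p y| ≤ M * |x - y| := fun x y => by
    have := Convex.norm_image_sub_le_of_norm_hasDerivWithin_le (f := p) (f' := p') (s := Set.univ)
      (C := M) (x := y) (y := x) (fun x _ => (hp x).hasDerivWithinAt) (fun x _ => hM x)
      convex_univ trivial trivial
    simpa using this
  have hG : HasDerivAt (fun w => ∫ r in u..w, φ (r - u) * q r) (φ (v - u) * q v) v := by
    have hc : Continuous fun r => φ (r - u) * q r := by fun_prop
    exact intervalIntegral.integral_hasDerivAt_right (hc.intervalIntegrable _ _)
      (hc.stronglyMeasurableAtFilter _ _) hc.continuousAt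
  have hF1 : HasDerivAt (fun w => ∫ r in v..u, φ (r - w) * p r)
      (∫ r in v..u, -ρ (r - v) * p r) v := by
    refine (intervalIntegral.hasDerivAt_integral_of_dominated_loc_of_deriv_le
      (F := fun w r => φ (r - w) * p r) (F' := fun w r => -ρ (r - w) * p r)
      (bound := fun _ => L * C) (s := Set.univ) Filter.univ_mem ?_ ?_ ?_ ?_ ?_ ?_).2
    · refine Filter.Eventually.of_forall fun w => Continuous.aestronglyMeasurable ?_
      fun_prop
    · refine Continuous.intervalIntegrable ?_ _ _
      fun_prop
    · refine Continuous.aestronglyMeasurable ?_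
      fun_prop
    · refine Filter.Eventually.of_forall fun r _ w _ => ?_
      rw [Real.norm_eq_abs, abs_mul, abs_neg]
      exact mul_le_mul (hL _) (hC _) (abs_nonneg _) hL0
    · exact intervalIntegrable_const
    · refine Filter.Eventually.of_forall fun r _ w _ => ?_
      have h1 : HasDerivAt (fun w => r - w) (-1) w := by
        simpa using (hasDerivAt_id w).const_sub r
      have h2 := ((hφ (r - w)).comp w h1).mul_const (p r)
      refine HasDerivAt.congr_deriv h2 ?_
      ring
  have hF2 : HasDerivAt (fun w => ∫ r in w..v, φ (r - w) * p r) 0 v := by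
    have hb : ∀ w, ‖∫ r in w..v, φ (r - w) * p r‖ ≤ L * C * |w - v| ^ 2 := by
      intro w
      have : ‖∫ r in w..v, φ (r - w) * p r‖ ≤ (L * |w - v| * C) * |v - w| := by
        refine intervalIntegral.norm_integral_le_of_norm_le_const fun r hr => ?_
        rw [Real.norm_eq_abs, abs_mul]
        have h1 := hlipφ (r - w) 0
        rw [hφ0, sub_zero, sub_zero] at h1
        have h2 : |r - w| ≤ |w - v| := by
          rw [abs_sub_comm w v]
          exact Set.abs_sub_left_of_mem_uIcc (Set.uIoc_subset_uIcc hr)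
        refine mul_le_mul (h1.trans (by gcongr)) (hC _) (abs_nonneg _) (by positivity)
      rw [abs_sub_comm v w] at this
      linarith
    rw [hasDerivAt_iff_isLittleO]
    have hO : (fun w => ∫ r in w..v, φ (r - w) * p r) =O[nhds v] fun w => (w - v) ^ 2 := by
      refine Asymptotics.IsBigO.of_bound (L * C) (Filter.Eventually.of_forall fun w => ?_)
      rw [norm_pow, Real.norm_eq_abs (w - v)]
      exact hb w
    have ho : (fun w : ℝ => (w - v) ^ 2) =o[nhds v] fun w => w - v := by
      have := Asymptotics.isLittleO_pow_sub_sub v one_lt_two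
      simpa using this
    simpa using hO.trans_isLittleO ho
  have hF : HasDerivAt (fun w => ∫ r in w..u, φ (r - w) * p r)
      (∫ r in v..u, -ρ (r - v) * p r) v := by
    have := hF2.add hF1
    rw [zero_add] at this
    refine this.congr_of_eventuallyEq (Filter.Eventually.of_forall fun w => ?_)
    have hc : Continuous fun r => φ (r - w) * p r := by fun_prop
    exact (intervalIntegral.integral_add_adjacent_intervals (hc.intervalIntegrable _ _)
      (hc.intervalIntegrable _ _)).symm
  refine ⟨_, hF.sub hG, ?_⟩
  have hρI : ∫ r in v..u, ρ (r - v) = φ (u - v) := by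
    have := intervalIntegral.integral_eq_sub_of_hasDerivAt (a := v) (b := u)
      (f := fun r => φ (r - v)) (f' := fun r => ρ (r - v))
      (fun r _ => (hφ (r - v)).comp_sub_const r v)
      (Continuous.intervalIntegrable (by fun_prop) _ _)
    simpa [hφ0] using this
  have hsplit : (∫ r in v..u, -ρ (r - v) * p r) =
      -(∫ r in v..u, ρ (r - v) * (p r - p v)) - φ (u - v) * p v := by
    rw [← hρI, ← intervalIntegral.integral_mul_const, ← intervalIntegral.integral_neg,
      ← intervalIntegral.integral_sub]
    · congr 1; ext r; ring
    · exact Continuous.intervalIntegrable (by fun_prop) _ _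
    · exact Continuous.intervalIntegrable (by fun_prop) _ _
  have hpt : ∀ r, ‖ρ (r - v) * (p r - p v)‖ ≤ M * ξ * ρ (r - v) := by
    intro r
    rw [Real.norm_eq_abs, abs_mul, abs_of_nonneg (hρ0 _)]
    by_cases h : ξ < |r - v|
    · simp [hsupp _ h]
    · have : |p r - p v| ≤ M * ξ := (hlipp r v).trans (by gcongr; exact not_lt.1 h)
      nlinarith [hρ0 (r - v)]
  have hI : |∫ r in v..u, ρ (r - v) * (p r - p v)| ≤ M * ξ := by
    have h1 : |∫ r in v..u, ρ (r - v) * (p r - p v)| ≤ |∫ r in v..u, M * ξ * ρ (r - v)| := by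
      refine intervalIntegral.norm_integral_le_abs_of_norm_le
        (Filter.Eventually.of_forall fun r => hpt r)
        (Continuous.intervalIntegrable (by fun_prop) _ _)
    rw [intervalIntegral.integral_const_mul, hρI, abs_mul, abs_of_nonneg (by positivity : 0 ≤ M * ξ)] at h1
    refine h1.trans (mul_le_of_le_one_right (by positivity) (hφ1 _))
  have e : φ (v - u) = -φ (u - v) := by rw [← hodd, neg_sub]
  rw [hsplit, e]
  set I := ∫ r in v..u, ρ (r - v) * (p r - p v)
  have h3 : |φ (u - v) * (p v - q v)| ≤ |p v - q v| := by
    rw [abs_mul]; exact mul_le_of_le_one_left (abs_nonneg _) (hφ1 _)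
  have h4 : -I - φ (u - v) * p v - -φ (u - v) * q v = -(I + φ (u - v) * (p v - q v)) := by ring
  rw [h4, abs_neg]
  have := abs_add_le I (φ (u - v) * (p v - q v))
  nlinarith [mul_nonneg hM0 hξ.le]

/-- Let `f, g : ℝ → ℝ` be `C¹` with bounded derivatives, and let `f`
moreover be `C²` with second derivative bounded by `M`. Then for every `ξ > 0` and all
`u, v`, the function `v ↦ f^{β_ξ}(u,v) − g^{β_ξ}(v,u)` is differentiable in `v` and
`|∂_v (f^{β_ξ}(u,v) − g^{β_ξ}(v,u))| ≤ 2 ξ ‖f''‖_∞ + |f'(v) − g'(v)|`. -/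
theorem stmt_8 (β : ℝ → ℝ) (hsmooth : ContDiff ℝ (⊤ : ℕ∞) β) (h0 : β 0 = 0)
    (heven : ∀ r, β (-r) = β r) (hconv : ∀ r, 0 ≤ deriv (deriv β) r)
    (hd1 : ∀ r, |deriv β r| ≤ 1)
    (hup : ∀ r : ℝ, 1 ≤ r → deriv β r = 1)
    (hdown : ∀ r : ℝ, r ≤ -1 → deriv β r = -1)
    (f g : ℝ → ℝ) (hf1 : ContDiff ℝ 1 f) (hg1 : ContDiff ℝ 1 g)
    (hf'bd : ∃ C, ∀ x, |deriv f x| ≤ C) (hg'bd : ∃ C, ∀ x, |deriv g x| ≤ C)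
    (hf2 : ContDiff ℝ 2 f)
    (M : ℝ) (hM : ∀ x, |deriv (deriv f) x| ≤ M)
    (ξ : ℝ) (hξ : 0 < ξ) (u v : ℝ) :
    ∃ D : ℝ, HasDerivAt (fun w => fluxBeta β ξ f u w - fluxBeta β ξ g w u) D v ∧
      |D| ≤ 2 * ξ * M + |deriv f v - deriv g v| := by
  have hβd : ∀ x, HasDerivAt β (deriv β x) x := fun x =>
    (hsmooth.differentiable (by simp) x).hasDerivAt
  have hB : ContDiff ℝ 1 (deriv β) :=
    (hsmooth.of_le (m := 1 + 1) (by norm_cast)).deriv'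
  have hBd : ∀ x, HasDerivAt (deriv β) (deriv (deriv β) x) x := fun x =>
    (hB.differentiable (by simp) x).hasDerivAt
  have hBc : Continuous (deriv (deriv β)) := hB.continuous_deriv (by simp)
  have hbx : deriv (betaXi β ξ) = fun r => deriv β (r / ξ) := by
    ext r
    have h := ((hβd (r / ξ)).comp r ((hasDerivAt_id r).div_const ξ)).const_mul ξ
    refine Eq.trans (HasDerivAt.deriv h) ?_
    field_simp
  have hdodd : ∀ x, deriv β (-x) = -deriv β x := by
    intro x
    have h := (hβd (-x)).comp x (hasDerivAt_neg x)
    have e : β ∘ Neg.neg = β := funext heven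
    rw [e] at h
    have := h.deriv
    linarith
  have hz : ∀ x, 1 < |x| → deriv (deriv β) x = 0 := by
    intro x hx
    rcases lt_abs.1 hx with h | h
    · have : deriv β =ᶠ[nhds x] fun _ => (1:ℝ) := by
        filter_upwards [lt_mem_nhds h] with y hy using hup y hy.le
      rw [this.deriv_eq]; simp
    · have : deriv β =ᶠ[nhds x] fun _ => (-1:ℝ) := by
        filter_upwards [gt_mem_nhds (show x < -1 by linarith)] with y hy using hdown y hy.le
      rw [this.deriv_eq]; simp
  obtain ⟨L, hL⟩ := (isCompact_Icc (a := (-1:ℝ)) (b := 1)).exists_bound_of_continuousOn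
    hBc.continuousOn
  have hL0 : 0 ≤ L := (norm_nonneg _).trans (hL 0 (by simp))
  have hL' : ∀ x, |deriv (deriv β) x| ≤ L := by
    intro x
    by_cases h : 1 < |x|
    · rw [hz x h]; simpa using hL0
    · exact hL x (abs_le.1 (not_lt.1 h))
  obtain ⟨C, hC⟩ := hf'bd
  have hf' : ContDiff ℝ 1 (deriv f) := (show ContDiff ℝ (1 + 1) f by
    simpa [one_add_one_eq_two] using hf2).deriv'
  simp only [fluxBeta, hbx]
  refine core_aux (fun r => deriv β (r / ξ)) (fun r => deriv (deriv β) (r / ξ) / ξ) ξ M (L / ξ) C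
    hξ ?_ ?_ ?_ ?_ ?_ ?_ ?_ ?_ (deriv f) (deriv (deriv f)) (deriv g) ?_ hM hC
    (hg1.continuous_deriv (by simp)) u v
  · intro x
    have h := (hBd (x / ξ)).comp x ((hasDerivAt_id x).div_const ξ)
    refine HasDerivAt.congr_deriv h ?_
    ring
  · fun_prop
  · intro x; exact div_nonneg (hconv _) hξ.le
  · have := hdodd 0
    simp at this ⊢
    linarith
  · intro x; simp only [neg_div, hdodd]
  · intro x; exact hd1 _
  · intro x hx
    rw [hz _ (by rw [abs_div, abs_of_pos hξ]; exact (one_lt_div hξ).2 hx), zero_div]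
  · intro x
    rw [abs_div, abs_of_pos hξ]
    gcongr
    exact hL' _
  · intro x; exact (hf'.differentiable (by simp) x).hasDerivAt
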